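/- Let A, B, C, D be commutative rings forming a Cartesian (pullback) square with maps A → B, A → C, B → D, C → D, such that A = B ×_D C and the map B → D is surjective. If P is a finitely generated projective B-module and Q is a finitely generated projective C-module together with an isomorphism of D-modules P ⊗_B D ≅ Q ⊗_C D, then the fiber product module M = P ×_{P⊗_B D} Q is a finitely generated projective A-module with M ⊗_A B ≅ P and M ⊗_A C ≅ Q. -/

import Mathlib

open scoped TensorProduct

/-- If a family in `M` maps to a family in `P` admitting coordinates `s` over `B` whose values on `M`
come from coordinates `σ` over `A`, then `M ⊗[A] B` is `P`. -/
theorem exists_baseChange_equiv_of_coordinates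
    {A B M P ι : Type*} [CommRing A] [CommRing B] [Algebra A B] [AddCommGroup M] [Module A M]
    [AddCommGroup P] [Module B P] [Module A P] [IsScalarTower A B P] [Fintype ι]
    (f : M →ₗ[A] P) (m : ι → M) (s : P →ₗ[B] (ι → B)) (hs : ∀ p, ∑ i, s p i • f (m i) = p)
    (σ : M → ι → A) (hσ : ∀ x, ∑ i, σ x i • m i = x)
    (hσs : ∀ x i, algebraMap A B (σ x i) = s (f x) i) :
    ∃ e : (B ⊗[A] M) ≃ₗ[B] P, ∀ x : M, e ((1 : B) ⊗ₜ[A] x) = f x := by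
  let g : P →ₗ[B] B ⊗[A] M := (Fintype.linearCombination B fun i => (1 : B) ⊗ₜ[A] m i) ∘ₗ s
  have hg : ∀ p, g p = ∑ i, s p i • ((1 : B) ⊗ₜ[A] m i) := fun p => by
    simp [g, Fintype.linearCombination_apply]
  refine ⟨LinearEquiv.ofLinearMap (f.liftBaseChange B) g ?_ ?_, fun x => ?_⟩
  · ext p
    simp only [LinearMap.comp_apply, hg, map_sum, map_smul, LinearMap.liftBaseChange_tmul, one_smul,
      hs, LinearMap.id_apply]
  · ext x
    simp only [TensorProduct.AlgebraTensorModule.curry_apply, LinearMap.restrictScalars_comp,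
      TensorProduct.curry_apply, LinearMap.comp_apply, LinearMap.coe_restrictScalars,
      LinearMap.liftBaseChange_tmul, one_smul, LinearMap.id_apply, hg, ← hσs, algebraMap_smul,
      ← TensorProduct.tmul_smul, ← TensorProduct.tmul_sum, hσ]
  · change f.liftBaseChange B ((1 : B) ⊗ₜ[A] x) = f x
    rw [LinearMap.liftBaseChange_tmul, one_smul]

/-- Coordinates on `Q` over `C` can be matched over `D` by coordinates on `P` over `B`, along an
isomorphism `D ⊗[B] P ≃ D ⊗[C] Q`, as soon as `B → D` is surjective. -/
theorem exists_coordinates_compatible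
    {B C D P Q ι : Type*} [CommRing B] [CommRing C] [CommRing D] [Algebra B D] [Algebra C D]
    (hsurj : Function.Surjective (algebraMap B D))
    [AddCommGroup P] [Module B P] [Module.Projective B P]
    [AddCommGroup Q] [Module C Q] [Fintype ι]
    (e : (D ⊗[B] P) ≃ₗ[D] (D ⊗[C] Q)) (p : ι → P) (q : ι → Q)
    (hpq : ∀ i, e ((1 : D) ⊗ₜ[B] p i) = (1 : D) ⊗ₜ[C] q i)
    (hp : Submodule.span B (Set.range p) = ⊤)
    (t : Q →ₗ[C] (ι → C)) (ht : ∀ y, ∑ i, t y i • q i = y) :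
    ∃ s : P →ₗ[B] (ι → B), (∀ x, ∑ i, s x i • p i = x) ∧
      ∀ x y, e ((1 : D) ⊗ₜ[B] x) = (1 : D) ⊗ₜ[C] y →
        ∀ i, algebraMap B D (s x i) = algebraMap C D (t y i) := by
  let f : (ι → B) →ₗ[B] P := Fintype.linearCombination B p
  have hf : ∀ v, f v = ∑ i, v i • p i := fun v => Fintype.linearCombination_apply B p v
  obtain ⟨s₀, hs₀⟩ := Module.projective_lifting_property f LinearMap.id (by
    rw [← LinearMap.range_eq_top, Fintype.range_linearCombination, hp])
  let πB : (ι → B) →ₗ[B] (ι → D) := (Algebra.linearMap B D).compLeft ι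
  let πC : (ι → C) →ₗ[C] (ι → D) := (Algebra.linearMap C D).compLeft ι
  have hπB : ∀ v i, πB v i = algebraMap B D (v i) := fun v i => rfl
  have hπC : ∀ v i, πC v i = algebraMap C D (v i) := fun v i => rfl
  let tD : D ⊗[C] Q →ₗ[D] (ι → D) := (πC ∘ₗ t).liftBaseChange D
  let sD : D ⊗[B] P →ₗ[D] (ι → D) := (πB ∘ₗ s₀).liftBaseChange D
  have htD : ∀ y, tD ((1 : D) ⊗ₜ[C] y) = πC (t y) := fun y => by simp [tD]
  have hsD : ∀ x, sD ((1 : D) ⊗ₜ[B] x) = πB (s₀ x) := fun x => by simp [sD]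
  have htD_coord : ∀ z, ∑ i, tD z i • ((1 : D) ⊗ₜ[C] q i) = z := by
    have : (Fintype.linearCombination D fun i => (1 : D) ⊗ₜ[C] q i) ∘ₗ tD = LinearMap.id := by
      ext y
      simp only [TensorProduct.AlgebraTensorModule.curry_apply, LinearMap.restrictScalars_comp,
        TensorProduct.curry_apply, LinearMap.comp_apply, LinearMap.coe_restrictScalars,
        LinearMap.id_apply, htD, Fintype.linearCombination_apply, hπC, algebraMap_smul,
        ← TensorProduct.tmul_smul, ← TensorProduct.tmul_sum, ht]
    intro z
    simpa [Fintype.linearCombination_apply] using LinearMap.congr_fun this z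
  have hπB_surj : Function.Surjective πB := fun v => by
    choose w hw using fun i => hsurj (v i)
    exact ⟨w, funext hw⟩
  obtain ⟨u, hu⟩ := Module.projective_lifting_property πB
    (tD.restrictScalars B ∘ₗ e.toLinearMap.restrictScalars B ∘ₗ TensorProduct.mk B D P 1) hπB_surj
  have hu' : ∀ x, πB (u x) = tD (e ((1 : D) ⊗ₜ[B] x)) := fun x => LinearMap.congr_fun hu x
  have hfu : ∀ x, (1 : D) ⊗ₜ[B] f (u x) = (1 : D) ⊗ₜ[B] x := fun x => by
    apply e.injective
    conv_rhs => rw [← htD_coord (e ((1 : D) ⊗ₜ[B] x)), ← hu']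
    simp only [hf, TensorProduct.tmul_sum, map_sum, hπB, ← hpq, ← map_smul, algebraMap_smul,
      TensorProduct.tmul_smul]
  have hfs₀ : ∀ x, f (s₀ x) = x := fun x => LinearMap.congr_fun hs₀ x
  refine ⟨u + s₀ ∘ₗ (LinearMap.id - f ∘ₗ u), fun x => ?_, fun x y hxy i => ?_⟩
  · rw [← hf]
    simp [hfs₀]
  · have h₀ : πB (s₀ (x - f (u x))) = 0 := by
      rw [← hsD, TensorProduct.tmul_sub, hfu, sub_self, map_zero]
    have h₁ : πB (u x + s₀ (x - f (u x))) = πC (t y) := by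
      rw [map_add, h₀, add_zero, hu', hxy, htD]
    exact congr_fun h₁ i

/-- If the image of a linear map `M → P` spans `P`, a finite `B`-module, then so does the image of a
finite subset of `M`. -/
theorem exists_finset_span_image_eq_top
    {B M P : Type*} [CommRing B] [AddCommGroup P] [Module B P] [Module.Finite B P] (f : M → P)
    (hf : Submodule.span B (Set.range f) = ⊤) :
    ∃ T : Finset M, Submodule.span B (f '' T) = ⊤ := by
  classical
  have hfg : (Submodule.span B (Set.range f)).FG := hf ▸ Module.Finite.fg_top
  obtain ⟨S, hS, hspan⟩ := Submodule.fg_span_iff_fg_span_finset_subset _ |>.mp hfg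
  rw [← Set.image_univ] at hS
  obtain ⟨T, -, rfl⟩ := Finset.subset_set_image_iff.mp hS
  exact ⟨T, by rw [← hf, hspan, Finset.coe_image]⟩

/-- **Milnor patching of finitely generated projective modules.**
Let `A = B ×_D C` be a Milnor square of commutative rings (a Cartesian square in which
`B → D` is surjective).  Given a finitely generated projective `B`-module `P`, a
finitely generated projective `C`-module `Q` and an isomorphism of `D`-modules
`e : P ⊗_B D ≅ Q ⊗_C D`, the fiber product module
`M = {(p, q) | e(1 ⊗ p) = 1 ⊗ q} ⊆ P × Q` is a finitely generated projective
`A`-module whose base changes `M ⊗_A B` and `M ⊗_A C` recover `P` and `Q` via the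
natural maps. -/
theorem milnor_patching_finite_projective
    {A B C D : Type*} [CommRing A] [CommRing B] [CommRing C] [CommRing D]
    [Algebra A B] [Algebra A C] [Algebra B D] [Algebra C D] [Algebra A D]
    [IsScalarTower A B D] [IsScalarTower A C D]
    (hsurj : Function.Surjective (algebraMap B D))
    (hpull : ∀ (b : B) (c : C), algebraMap B D b = algebraMap C D c →
      ∃! a : A, algebraMap A B a = b ∧ algebraMap A C a = c)
    (P : Type*) [AddCommGroup P] [Module B P] [Module A P] [IsScalarTower A B P]
    [Module.Finite B P] [Module.Projective B P]
    (Q : Type*) [AddCommGroup Q] [Module C Q] [Module A Q] [IsScalarTower A C Q]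
    [Module.Finite C Q] [Module.Projective C Q]
    (e : (D ⊗[B] P) ≃ₗ[D] (D ⊗[C] Q))
    (M : Submodule A (P × Q))
    (hM : ∀ x : P × Q, x ∈ M ↔ e ((1 : D) ⊗ₜ[B] x.1) = (1 : D) ⊗ₜ[C] x.2) :
    Module.Finite A M ∧ Module.Projective A M ∧
      (∃ eB : (B ⊗[A] M) ≃ₗ[B] P, ∀ m : M, eB ((1 : B) ⊗ₜ[A] m) = (m : P × Q).1) ∧
      (∃ eC : (C ⊗[A] M) ≃ₗ[C] Q, ∀ m : M, eC ((1 : C) ⊗ₜ[A] m) = (m : P × Q).2) := by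
  classical
  let fP : M →ₗ[A] P := LinearMap.fst A P Q ∘ₗ M.subtype
  let fQ : M →ₗ[A] Q := LinearMap.snd A P Q ∘ₗ M.subtype
  have hfM : ∀ m : M, e ((1 : D) ⊗ₜ[B] fP m) = (1 : D) ⊗ₜ[C] fQ m := fun m => (hM m).mp m.2
  have hmk : ∀ x y, e ((1 : D) ⊗ₜ[B] x) = (1 : D) ⊗ₜ[C] y → ∃ m : M, fP m = x ∧ fQ m = y :=
    fun x y h => ⟨⟨(x, y), (hM _).mpr h⟩, rfl, rfl⟩
  have hfQ : Function.Surjective fQ := fun y => by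
    obtain ⟨x, hx⟩ := TensorProduct.mk_surjective B P D hsurj (e.symm ((1 : D) ⊗ₜ[C] y))
    obtain ⟨m, -, hm⟩ := hmk x y (by
      rw [← e.apply_symm_apply ((1 : D) ⊗ₜ[C] y), ← hx, TensorProduct.mk_apply])
    exact ⟨m, hm⟩
  have hspanP : Submodule.span B (Set.range fP) = ⊤ := by
    have key : ∀ z : D ⊗[C] Q,
        ∃ x ∈ Submodule.span B (Set.range fP), e ((1 : D) ⊗ₜ[B] x) = z := fun z => by
      induction z with
      | zero => exact ⟨0, zero_mem _, by simp⟩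
      | tmul d y =>
        obtain ⟨b, rfl⟩ := hsurj d
        obtain ⟨m, rfl⟩ := hfQ y
        refine ⟨b • fP m, Submodule.smul_mem _ _ (Submodule.subset_span ⟨m, rfl⟩), ?_⟩
        rw [TensorProduct.tmul_smul, ← algebraMap_smul D b, map_smul, hfM, TensorProduct.smul_tmul',
          smul_eq_mul, mul_one]
      | add z w hz hw =>
        obtain ⟨x, hx, rfl⟩ := hz
        obtain ⟨y, hy, rfl⟩ := hw
        exact ⟨x + y, add_mem hx hy, by rw [TensorProduct.tmul_add, map_add]⟩
    refine eq_top_iff.mpr fun x _ => ?_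
    obtain ⟨x', hx', h⟩ := key (e ((1 : D) ⊗ₜ[B] x))
    obtain ⟨m, hm, -⟩ := hmk (x - x') 0 (by
      rw [TensorProduct.tmul_sub, map_sub, h, sub_self, TensorProduct.tmul_zero])
    rw [← sub_add_cancel x x']
    exact add_mem (Submodule.subset_span ⟨m, hm⟩) hx'
  obtain ⟨T₁, hT₁⟩ := exists_finset_span_image_eq_top fP hspanP
  obtain ⟨T₂, hT₂⟩ := exists_finset_span_image_eq_top (B := C) fQ (by
    rw [hfQ.range_eq, Submodule.span_univ])
  let T : Finset M := T₁ ∪ T₂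
  let m : T → M := Subtype.val
  have hp : Submodule.span B (Set.range (fP ∘ m)) = ⊤ := by
    refine top_le_iff.mp (hT₁ ▸ Submodule.span_mono ?_)
    rintro _ ⟨x, hx, rfl⟩
    exact ⟨⟨x, Finset.mem_union_left _ hx⟩, rfl⟩
  have hq : Submodule.span C (Set.range (fQ ∘ m)) = ⊤ := by
    refine top_le_iff.mp (hT₂ ▸ Submodule.span_mono ?_)
    rintro _ ⟨x, hx, rfl⟩
    exact ⟨⟨x, Finset.mem_union_right _ hx⟩, rfl⟩
  obtain ⟨t, ht⟩ := Module.projective_lifting_property (Fintype.linearCombination C (fQ ∘ m))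
    LinearMap.id (by rw [← LinearMap.range_eq_top, Fintype.range_linearCombination, hq])
  replace ht : ∀ y, ∑ i, t y i • fQ (m i) = y := fun y => by
    simpa [Fintype.linearCombination_apply] using LinearMap.congr_fun ht y
  obtain ⟨s, hs, hst⟩ := exists_coordinates_compatible hsurj e (fP ∘ m) (fQ ∘ m)
    (fun i => hfM (m i)) hp t ht
  choose σ hσ using fun (x : M) (i : T) =>
    (hpull (s (fP x) i) (t (fQ x) i) (hst _ _ (hfM x) i)).exists
  have hinj : ∀ a a' : A, algebraMap A B a = algebraMap A B a' →
      algebraMap A C a = algebraMap A C a' → a = a' := fun a a' hB hC =>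
    (hpull (algebraMap A B a') (algebraMap A C a') (by
      rw [← IsScalarTower.algebraMap_apply, ← IsScalarTower.algebraMap_apply])).unique
      ⟨hB, hC⟩ ⟨rfl, rfl⟩
  let σl : M →ₗ[A] (T → A) :=
    { toFun := σ
      map_add' := fun x y => funext fun i => hinj _ _
        (by simp only [Pi.add_apply, map_add, (hσ _ _).1])
        (by simp only [Pi.add_apply, map_add, (hσ _ _).2])
      map_smul' := fun a x => funext fun i => hinj _ _
        (by
          rw [(hσ _ _).1, map_smul, ← algebraMap_smul B a (fP x), map_smul]
          simp [(hσ _ _).1])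
        (by
          rw [(hσ _ _).2, map_smul, ← algebraMap_smul C a (fQ x), map_smul]
          simp [(hσ _ _).2]) }
  have hσm : ∀ x, ∑ i, σ x i • m i = x := fun x => by
    apply Subtype.ext
    apply Prod.ext
    · change fP _ = fP x
      simp only [map_sum, map_smul]
      simp only [← algebraMap_smul B (σ _ _), (hσ _ _).1]
      exact hs (fP x)
    · change fQ _ = fQ x
      simp only [map_sum, map_smul]
      simp only [← algebraMap_smul C (σ _ _), (hσ _ _).2]
      exact ht (fQ x)
  have hsplit : Fintype.linearCombination A m ∘ₗ σl = LinearMap.id :=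
    LinearMap.ext fun x => (Fintype.linearCombination_apply A m (σ x)).trans (hσm x)
  exact ⟨Module.Finite.of_surjective _ (LinearMap.surjective_of_comp_eq_id _ _ hsplit),
    Module.Projective.of_split _ _ hsplit,
    exists_baseChange_equiv_of_coordinates fP m s hs σ hσm fun x i => (hσ x i).1,
    exists_baseChange_equiv_of_coordinates fQ m t ht σ hσm fun x i => (hσ x i).2⟩
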